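/- arXiv:1707.07339 — 3 statements merged into one kernel-verified Lean document; each statement's English description precedes it below -/
import Mathlib

section
/- Let C be a finite inverse category and K an object of C. Then there exists a linear order < on the type of non-identity morphisms out of K (pairs (Y, f) with f : K ⟶ Y and Y ≠ K) such that whenever f : K ⟶ Y and g : Y ⟶ Z are morphisms with Y ≠ K and Y ≠ Z, one has (Y, f) < (Z, f ≫ g). -/
open CategoryTheory

/-- In a skeletal category without non-identity endomorphisms, the morphisms out of `K` are
partially ordered by factorization. -/
abbrev factorizationOrder {C : Type*} [Category C]
    (hskel : ∀ X Y : C, Nonempty (X ≅ Y) → X = Y)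
    (hend : ∀ (X : C) (f : X ⟶ X), f = 𝟙 X) (K : C) :
    PartialOrder (Σ Y : C, (K ⟶ Y)) where
  le p q := ∃ g : p.1 ⟶ q.1, p.2 ≫ g = q.2
  le_refl p := ⟨𝟙 _, Category.comp_id _⟩
  le_trans p q r := by
    rintro ⟨g, hg⟩ ⟨h, hh⟩
    exact ⟨g ≫ h, by rw [← Category.assoc, hg, hh]⟩
  le_antisymm := by
    rintro ⟨Y, f⟩ ⟨Z, f'⟩ ⟨g, hg⟩ ⟨h, hh⟩
    dsimp only at g h hg hh
    obtain rfl := hskel Y Z ⟨⟨g, h, hend _ _, hend _ _⟩⟩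
    rw [← hg, hend Y g, Category.comp_id]

/-- A finite inverse category admits, for each object `K`, a linear order on
the non-identity morphisms out of `K` such that a morphism strictly precedes
each of its proper composites (the order `<_m` of the paper). -/
theorem stmt9 {C : Type*} [Category C]
    (hfin : Finite (Σ (X : C) (Y : C), X ⟶ Y))
    (hskel : ∀ X Y : C, Nonempty (X ≅ Y) → X = Y)
    (hend : ∀ (X : C) (f : X ⟶ X), f = 𝟙 X) (K : C) :
    ∃ l : LinearOrder {p : Σ Y : C, (K ⟶ Y) // p.1 ≠ K},
      ∀ {Y Z : C} (f : K ⟶ Y) (g : Y ⟶ Z) (hYK : Y ≠ K) (hYZ : Y ≠ Z)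
        (hZK : Z ≠ K),
        l.lt ⟨⟨Y, f⟩, hYK⟩ ⟨⟨Z, f ≫ g⟩, hZK⟩ := by
  let _ := factorizationOrder hskel hend K
  let l : LinearOrder (LinearExtension {p : Σ Y : C, (K ⟶ Y) // p.1 ≠ K}) := inferInstance
  refine ⟨l, fun {Y Z} f g hYK hYZ hZK => ?_⟩
  have hle : (⟨⟨Y, f⟩, hYK⟩ : {p : Σ Y : C, (K ⟶ Y) // p.1 ≠ K}) ≤ ⟨⟨Z, f ≫ g⟩, hZK⟩ :=
    ⟨g, rfl⟩
  refine @lt_of_le_of_ne _ l.toPartialOrder _ _ (toLinearExtension.monotone hle) fun h => hYZ ?_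
  exact congrArg (fun p : {p : Σ Y : C, (K ⟶ Y) // p.1 ≠ K} => p.1.1) h
end

section
/- Let C be a finite inverse category whose type of objects is nonempty. Then there exists an object K of C such that every morphism with codomain K has domain K (equivalently, every morphism into K is the identity 𝟙 K). -/
open CategoryTheory

/-- A nonempty finite inverse category has an object `K` receiving no
non-identity morphisms: every morphism into `K` has domain `K` (and is hence
the identity). -/
theorem stmt12 {C : Type*} [Category C]
    (hfin : Finite (Σ (X : C) (Y : C), X ⟶ Y))
    (hskel : ∀ X Y : C, Nonempty (X ≅ Y) → X = Y)
    (hend : ∀ (X : C) (f : X ⟶ X), f = 𝟙 X)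
    (hne : Nonempty C) :
    ∃ K : C, ∀ (X : C) (_ : X ⟶ K), X = K := by
  have : Finite C := Finite.of_injective
    (fun X : C => (⟨X, X, 𝟙 X⟩ : Σ (X : C) (Y : C), X ⟶ Y))
    fun _ _ h => congrArg Sigma.fst h
  let _ : PartialOrder C :=
    { le := fun X Y => Nonempty (X ⟶ Y)
      le_refl := fun X => ⟨𝟙 X⟩
      le_trans := fun _ _ _ ⟨f⟩ ⟨g⟩ => ⟨f ≫ g⟩
      le_antisymm := fun X Y ⟨f⟩ ⟨g⟩ => hskel X Y ⟨⟨f, g, hend X _, hend Y _⟩⟩ }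
  obtain ⟨K, hK⟩ := (Set.finite_univ (α := C)).exists_minimal Set.univ_nonempty
  exact ⟨K, fun X f => hK.eq_of_le (Set.mem_univ X) ⟨f⟩⟩
end

section
/- Let C be a finite inverse category whose type of objects is nonempty. Then there exists an object K of C such that every morphism with domain K has codomain K (equivalently, every morphism out of K is the identity 𝟙 K, i.e., the total cosieve on K is empty). -/
open CategoryTheory

/-- A nonempty finite inverse category has an object `K` with empty total
cosieve: every morphism out of `K` has codomain `K` (and is hence the
identity). -/
theorem stmt13 {C : Type*} [Category C]
    (hfin : Finite (Σ (X : C) (Y : C), X ⟶ Y))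
    (hskel : ∀ X Y : C, Nonempty (X ≅ Y) → X = Y)
    (hend : ∀ (X : C) (f : X ⟶ X), f = 𝟙 X)
    (hne : Nonempty C) :
    ∃ K : C, ∀ (Y : C) (_ : K ⟶ Y), Y = K := by
  have : Finite C :=
    Finite.of_injective (fun X : C ↦ (⟨X, X, 𝟙 X⟩ : Σ (X : C) (Y : C), X ⟶ Y))
      fun _ _ h ↦ congrArg Sigma.fst h
  let _ : PartialOrder C :=
    { le := fun X Y ↦ Nonempty (X ⟶ Y)
      le_refl := fun X ↦ ⟨𝟙 X⟩
      le_trans := fun _ _ _ ⟨f⟩ ⟨g⟩ ↦ ⟨f ≫ g⟩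
      le_antisymm := fun X Y ⟨f⟩ ⟨g⟩ ↦ hskel X Y ⟨⟨f, g, hend X _, hend Y _⟩⟩ }
  obtain ⟨K, -, hK⟩ := Set.finite_univ.exists_maximal (Set.univ_nonempty (α := C))
  exact ⟨K, fun Y f ↦ le_antisymm (hK (Set.mem_univ Y) ⟨f⟩) ⟨f⟩⟩
end
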